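/- Every permutation of [n] can be sorted to the identity using at most ⌊2n/3⌋ cut-and-paste moves. -/

import Mathlib

/-- A cut-and-paste move: cut out a contiguous substring `M`, optionally
reverse it, and paste it back at any position of the remaining string. -/
def IsMove (l l' : List ℕ) : Prop :=
  ∃ P M S X Y : List ℕ, l = P ++ M ++ S ∧ X ++ Y = P ++ S ∧
    (l' = X ++ M ++ Y ∨ l' = X ++ M.reverse ++ Y)

/-- `MoveSeq k l l'` : `l` can be transformed into `l'` by exactly `k`
cut-and-paste moves. -/
inductive MoveSeq : ℕ → List ℕ → List ℕ → Prop
  | refl (l : List ℕ) : MoveSeq 0 l l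
  | step {k : ℕ} {l l' l'' : List ℕ} :
      IsMove l l' → MoveSeq k l' l'' → MoveSeq (k + 1) l l''

/-- Number of parity adjacencies: consecutive pairs of opposite parity. -/
def parityAdj (l : List ℕ) : ℕ :=
  (l.zip l.tail).countP (fun p => p.1 % 2 != p.2 % 2)

/-- Number of adjacencies: consecutive pairs whose values differ by 1. -/
def adjCount (l : List ℕ) : ℕ :=
  (l.zip l.tail).countP (fun p => (p.1 + 1 == p.2) || (p.2 + 1 == p.1))


namespace CP

def Adj (a b : ℕ) : Prop := a + 1 = b ∨ b + 1 = a

theorem Adj.symm {a b : ℕ} (h : Adj a b) : Adj b a := Or.symm h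

def Con (L : List ℕ) (a b : ℕ) : Prop := [a, b] <:+: L ∨ [b, a] <:+: L

theorem Con.symm {L : List ℕ} {a b : ℕ} (h : Con L a b) : Con L b a := Or.symm h

theorem Con.mem {L : List ℕ} {a b : ℕ} (h : Con L a b) : a ∈ L ∧ b ∈ L := by
  rcases h with h | h <;> exact ⟨h.subset (by simp), h.subset (by simp)⟩

theorem Con.mono {L M : List ℕ} {a b : ℕ} (h : Con L a b) (hm : L <:+: M) : Con M a b := by
  rcases h with h | h
  · exact Or.inl (h.trans hm)
  · exact Or.inr (h.trans hm)

theorem Con.rev {L : List ℕ} {a b : ℕ} (h : Con L a b) : Con L.reverse a b := by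
  rcases h with h | h
  · right; simpa using List.reverse_infix.2 h
  · left; simpa using List.reverse_infix.2 h

/-- junction of two lists -/
def Jn (A B : List ℕ) (a b : ℕ) : Prop := A.getLast? = some a ∧ B.head? = some b

theorem infix_append_pair {A B : List ℕ} {a b : ℕ} (h : [a, b] <:+: A ++ B) :
    [a, b] <:+: A ∨ [a, b] <:+: B ∨ Jn A B a b := by
  induction A with
  | nil => right; left; simpa using h
  | cons c A ih =>
    rw [List.cons_append, List.infix_cons_iff] at h
    rcases h with h | h
    · rw [List.cons_prefix_cons] at h
      obtain ⟨rfl, h⟩ := h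
      cases A with
      | nil =>
        right; right
        cases B with
        | nil => simp at h
        | cons d B => 
          simp at h
          simp [Jn, h]
      | cons d A =>
        simp at h
        subst h
        left
        exact ⟨[], A, by simp⟩
    · rcases ih h with h | h | h
      · left; exact h.trans (List.suffix_cons c A).isInfix
      · right; left; exact h
      · right; right
        cases A with
        | nil => simp [Jn] at h
        | cons d A => simpa [Jn] using h

theorem Con.split {A B : List ℕ} {a b : ℕ} (h : Con (A ++ B) a b) :
    Con A a b ∨ Con B a b ∨ Jn A B a b ∨ Jn A B b a := by
  rcases h with h | h <;> rcases infix_append_pair h with h | h | h <;> simp [Con, h]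

def Pres (L M : List ℕ) : Prop := ∀ a b, Adj a b → Con L a b → Con M a b

/-- the junction is not a bond -/
def NJ (A B : List ℕ) : Prop := ∀ a b, Jn A B a b → ¬ Adj a b

theorem Pres.append {A B M : List ℕ} (hA : Pres A M) (hB : Pres B M) (h : NJ A B) :
    Pres (A ++ B) M := by
  intro a b hab hc
  rcases hc.split with hc | hc | hc | hc
  · exact hA _ _ hab hc
  · exact hB _ _ hab hc
  · exact absurd hab (h _ _ hc)
  · exact absurd hab.symm (h _ _ hc)

theorem Pres.of_infix {A M : List ℕ} (h : A <:+: M) : Pres A M :=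
  fun _ _ _ hc => hc.mono h

theorem Pres.of_rev {A M : List ℕ} (h : A.reverse <:+: M) : Pres A M :=
  fun _ _ _ hc => hc.rev.mono h

theorem Con.of_jn {A B : List ℕ} {a b : ℕ} (h : Jn A B a b) : Con (A ++ B) a b := by
  obtain ⟨h1, h2⟩ := h
  obtain ⟨A', rfl⟩ := List.getLast?_eq_some_iff.1 h1
  obtain ⟨B', rfl⟩ := List.head?_eq_some_iff.1 h2
  exact Or.inl ⟨A', B', by simp⟩

/-- discrete intermediate value: a missing value between the ends gives a non-bond -/
theorem exists_split (T : List ℕ) (a c v : ℕ) (ha : T.head? = some a) (hc : T.getLast? = some c)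
    (hv : (a < v ∧ v < c) ∨ (c < v ∧ v < a)) (hT : v ∉ T) :
    ∃ T1 T2, T = T1 ++ T2 ∧ T1.head? = some a ∧ T2.getLast? = some c ∧ NJ T1 T2 := by
  induction T generalizing a with
  | nil => simp at ha
  | cons d T ih =>
    simp at ha; subst ha
    cases T with
    | nil => simp at hc; omega
    | cons e T =>
      have hc' : (e :: T).getLast? = some c := by simpa using hc
      by_cases hde : Adj d e
      · have hve : v ≠ e := by rintro rfl; simp at hT
        have hvd : v ≠ d := by rintro rfl; simp at hT
        have hec : (e < v ∧ v < c) ∨ (c < v ∧ v < e) := by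
          unfold Adj at hde; omega
        obtain ⟨T1, T2, h1, h2, h3, h4⟩ := ih e (by simp) hc' hec (by simp at hT ⊢; tauto)
        refine ⟨d :: T1, T2, by simp [h1], by simp, h3, ?_⟩
        intro a b hj
        refine h4 a b ⟨?_, hj.2⟩
        cases T1 with
        | nil => simp at h2
        | cons => simpa [Jn] using hj.1
      · refine ⟨[d], e :: T, by simp, by simp, hc', ?_⟩
        intro a b hj
        simp [Jn] at hj
        rw [← hj.1, ← hj.2]; exact hde

/-! ### the potential -/

def Sing (n : ℕ) (B : Finset ℕ) : Finset ℕ :=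
  (Finset.Icc 1 n).filter (fun v => v ∉ B ∧ v - 1 ∉ B)

def Psi (n : ℕ) (B : Finset ℕ) : ℕ := 3 * B.card + (Sing n B).card

theorem sing_anti {n : ℕ} {B B' : Finset ℕ} (h : B ⊆ B') : Sing n B' ⊆ Sing n B := by
  intro v hv
  simp only [Sing, Finset.mem_filter] at hv ⊢
  exact ⟨hv.1, fun h' => hv.2.1 (h h'), fun h' => hv.2.2 (h h')⟩

theorem sing_add {n : ℕ} {B : Finset ℕ} {v : ℕ} :
    Sing n B ⊆ Sing n (insert v B) ∪ (Sing n B ∩ {v, v + 1}) := by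
  intro w hw
  have hw' := hw
  simp only [Sing, Finset.mem_filter, Finset.mem_union, Finset.mem_inter, Finset.mem_insert,
    Finset.mem_singleton, Finset.mem_Icc] at hw ⊢
  by_cases h1 : w = v
  · tauto
  · by_cases h2 : w = v + 1
    · tauto
    · left
      refine ⟨hw.1, by tauto, ?_⟩
      rintro (h | h)
      · omega
      · tauto

theorem psi_add {n : ℕ} {B : Finset ℕ} {v : ℕ} (hv : v ∉ B) :
    Psi n B + 3 ≤ Psi n (insert v B) + (Sing n B ∩ {v, v + 1}).card := by
  have h1 := Finset.card_le_card (sing_add (n := n) (B := B) (v := v))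
  have h2 := Finset.card_union_le (Sing n (insert v B)) (Sing n B ∩ {v, v + 1})
  have h3 := Finset.card_insert_of_notMem hv
  unfold Psi
  omega

theorem psi_add1 {n : ℕ} {B : Finset ℕ} {v : ℕ} (hv : v ∉ B) :
    Psi n B + 1 ≤ Psi n (insert v B) := by
  have h := psi_add (n := n) hv
  have h2 : (Sing n B ∩ {v, v + 1}).card ≤ 2 :=
    (Finset.card_le_card Finset.inter_subset_right).trans Finset.card_le_two
  omega

theorem psi_add2 {n : ℕ} {B : Finset ℕ} {v : ℕ} (hv : v ∉ B)
    (hs : v ∉ Sing n B ∨ v + 1 ∉ Sing n B) :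
    Psi n B + 2 ≤ Psi n (insert v B) := by
  have h := psi_add (n := n) hv
  have h2 : (Sing n B ∩ {v, v + 1}).card ≤ 1 := by
    rcases hs with hs | hs
    · refine (Finset.card_le_card (t := {v + 1}) ?_).trans (by simp)
      intro w hw
      simp only [Finset.mem_inter, Finset.mem_insert, Finset.mem_singleton] at hw ⊢
      rcases hw.2 with rfl | h'
      · exact absurd hw.1 hs
      · exact h'
    · refine (Finset.card_le_card (t := {v}) ?_).trans (by simp)
      intro w hw
      simp only [Finset.mem_inter, Finset.mem_insert, Finset.mem_singleton] at hw ⊢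
      rcases hw.2 with h' | rfl
      · exact h'
      · exact absurd hw.1 hs
  omega

theorem psi_add3 {n : ℕ} {B : Finset ℕ} {v : ℕ} (hv : v ∉ B)
    (hs : v ∉ Sing n B) (hs' : v + 1 ∉ Sing n B) :
    Psi n B + 3 ≤ Psi n (insert v B) := by
  have h := psi_add (n := n) hv
  have h2 : (Sing n B ∩ {v, v + 1}) = ∅ := by
    ext w
    simp only [Finset.mem_inter, Finset.mem_insert, Finset.mem_singleton, Finset.notMem_empty,
      iff_false]
    rintro ⟨h1, rfl | rfl⟩ <;> contradiction
  rw [h2] at h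
  simpa using h

theorem psi_mono {n : ℕ} {B B' : Finset ℕ} (h : B ⊆ B') : Psi n B ≤ Psi n B' := by
  have key : ∀ D : Finset ℕ, Psi n B ≤ Psi n (B ∪ D) := by
    intro D
    induction D using Finset.induction_on with
    | empty => simp
    | insert a s _ ih =>
      rw [Finset.union_insert]
      by_cases ha : a ∈ B ∪ s
      · rwa [Finset.insert_eq_of_mem ha]
      · have := psi_add1 (n := n) ha
        omega
  have := key B'
  rwa [Finset.union_eq_right.2 h] at this

theorem psi_start (n : ℕ) (B : Finset ℕ) : n ≤ Psi n B := by
  have h : Finset.Icc 1 n ⊆ Sing n B ∪ (B ∪ B.image (· + 1)) := by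
    intro v hv
    simp only [Sing, Finset.mem_filter, Finset.mem_union, Finset.mem_image]
    by_cases h1 : v ∈ B
    · tauto
    · by_cases h2 : v - 1 ∈ B
      · right; right; exact ⟨v - 1, h2, by simp at hv; omega⟩
      · tauto
  have h1 := Finset.card_le_card h
  have h2 := Finset.card_union_le (Sing n B) (B ∪ B.image (· + 1))
  have h3 := Finset.card_union_le B (B.image (· + 1))
  have h4 : (B.image (· + 1)).card ≤ B.card := Finset.card_image_le
  simp at h1
  unfold Psi
  omega

/-- upper bound through the missing bonds -/
theorem psi_le_of_missing {n j : ℕ} {B D : Finset ℕ} (hB : B ⊆ Finset.range (n + 1))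
    (hD : D ⊆ Finset.range (n + 1) \ B) (hj : j ≤ D.card) (hj0 : 0 < j) :
    Psi n B + 2 * j ≤ 3 * n + 2 := by
  set M := Finset.range (n + 1) \ B with hM
  have hDM := Finset.card_le_card hD
  have hne : M.Nonempty := Finset.card_pos.1 (by omega)
  have hc : M.card + B.card = n + 1 := by
    have := Finset.card_sdiff_add_card_eq_card hB
    simpa using this
  have hs : (Sing n B).card ≤ (M.erase (M.max' hne)).card := by
    refine Finset.card_le_card_of_injOn (fun v => v - 1) ?_ ?_
    · intro v hv
      simp only [Sing, Finset.coe_filter, Set.mem_ofPred_eq, Finset.mem_Icc] at hv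
      have hvM : v ∈ M := by simp [hM]; exact ⟨by omega, hv.2.1⟩
      have := Finset.le_max' M v hvM
      simp only [Finset.coe_erase, Set.mem_sdiff, Finset.mem_coe, Set.mem_singleton_iff]
      refine ⟨by simp [hM]; exact ⟨by omega, hv.2.2⟩, by omega⟩
    · intro v hv w hw h
      simp only [Sing, Finset.coe_filter, Set.mem_ofPred_eq, Finset.mem_Icc] at hv hw
      simp only at h
      omega
  rw [Finset.card_erase_of_mem (Finset.max'_mem _ _)] at hs
  have := Finset.card_pos.2 hne
  unfold Psi
  omega

theorem psi_le_of_two {n b d : ℕ} {B : Finset ℕ} (hB : B ⊆ Finset.range (n + 1))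
    (hb : b ∉ B) (hb1 : b + 1 ∈ B) (hd : d ∉ B) (hbd : b < d) (hdn : d ≤ n) :
    Psi n B + 3 ≤ 3 * n := by
  set M := Finset.range (n + 1) \ B with hM
  have hbM : b ∈ M := by simp [hM]; exact ⟨by omega, hb⟩
  have hdM : d ∈ M := by simp [hM]; exact ⟨by omega, hd⟩
  have hne : M.Nonempty := ⟨b, hbM⟩
  have hmax := Finset.le_max' M d hdM
  have hc : M.card + B.card = n + 1 := by
    have := Finset.card_sdiff_add_card_eq_card hB
    simpa using this
  have hs : (Sing n B).card ≤ ((M.erase (M.max' hne)).erase b).card := by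
    refine Finset.card_le_card_of_injOn (fun v => v - 1) ?_ ?_
    · intro v hv
      simp only [Sing, Finset.coe_filter, Set.mem_ofPred_eq, Finset.mem_Icc] at hv
      have hvM : v ∈ M := by simp [hM]; exact ⟨by omega, hv.2.1⟩
      have := Finset.le_max' M v hvM
      simp only [Finset.coe_erase, Set.mem_sdiff, Finset.mem_coe, Set.mem_singleton_iff]
      refine ⟨⟨by simp [hM]; exact ⟨by omega, hv.2.2⟩, by omega⟩, ?_⟩
      intro h
      have : v = b + 1 := by omega
      subst this
      exact hv.2.1 hb1
    · intro v hv w hw h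
      simp only [Sing, Finset.coe_filter, Set.mem_ofPred_eq, Finset.mem_Icc] at hv hw
      simp only at h
      omega
  have hbe : b ∈ M.erase (M.max' hne) := Finset.mem_erase.2 ⟨by omega, hbM⟩
  have hcc : 2 ≤ M.card := by
    have := Finset.card_le_card (show ({b, d} : Finset ℕ) ⊆ M by
      intro z hz; simp at hz; rcases hz with rfl | rfl <;> assumption)
    rwa [Finset.card_pair (by omega)] at this
  rw [Finset.card_erase_of_mem hbe, Finset.card_erase_of_mem (Finset.max'_mem _ _)] at hs
  unfold Psi
  omega

theorem nbr {A T : List ℕ} {q y : ℕ} (hnd : (A ++ q :: T).Nodup) (h : Con (A ++ q :: T) q y) :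
    A.getLast? = some y ∨ T.head? = some y := by
  have hqA : q ∉ A := by
    intro h'
    rw [List.nodup_append] at hnd
    exact hnd.2.2 q h' q (by simp) rfl
  have hqT : q ∉ T := by
    rw [List.nodup_append] at hnd
    exact (List.nodup_cons.1 hnd.2.1).1
  rcases h.split with h | h | h | h
  · exact absurd h.mem.1 hqA
  · have h : Con ([q] ++ T) q y := h
    rcases h.split with h | h | h | h
    · rcases h with h | h <;> · have := h.length_le; simp at this
    · exact absurd h.mem.1 hqT
    · exact Or.inr h.2
    · exact absurd (List.mem_of_mem_head? h.2) hqT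
  · exact absurd (List.mem_of_mem_getLast? h.1) hqA
  · exact Or.inl h.1

open Classical in
noncomputable def Bd (n : ℕ) (L : List ℕ) : Finset ℕ :=
  (Finset.range (n + 1)).filter (fun v => Con L v (v + 1))

theorem mem_Bd {n : ℕ} {L : List ℕ} {v : ℕ} : v ∈ Bd n L ↔ v ≤ n ∧ Con L v (v + 1) := by
  simp [Bd]

theorem Bd_sub {n : ℕ} {L : List ℕ} : Bd n L ⊆ Finset.range (n + 1) := by
  intro v hv
  have := (mem_Bd.1 hv).1
  simp; omega

theorem Bd_mono {n : ℕ} {L L' : List ℕ} (h : Pres L L') : Bd n L ⊆ Bd n L' := by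
  intro v hv
  rw [mem_Bd] at hv ⊢
  exact ⟨hv.1, h _ _ (Or.inl rfl) hv.2⟩

theorem not_sing {n : ℕ} {L : List ℕ} {a c : ℕ} (h : Adj a c) (hc : Con L a c) :
    a ∉ Sing n (Bd n L) := by
  intro hs
  simp only [Sing, Finset.mem_filter, Finset.mem_Icc, mem_Bd] at hs
  rcases h with rfl | rfl
  · exact hs.2.1 ⟨hs.1.2, hc⟩
  · exact hs.2.2 ⟨by omega, by simpa using hc.symm⟩

theorem min_cases {a c : ℕ} (h : Adj a c) :
    (min a c = a ∧ min a c + 1 = c) ∨ (min a c = c ∧ min a c + 1 = a) := by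
  unfold Adj at h; omega

theorem min_mem {n : ℕ} {L : List ℕ} {a c : ℕ} (h : Adj a c) (ha : a ≤ n + 1) (hc : c ≤ n + 1) :
    min a c ∈ Bd n L ↔ Con L a c := by
  rw [mem_Bd]
  rcases min_cases h with ⟨h1, h2⟩ | ⟨h1, h2⟩
  · rw [h2, h1]; constructor
    · exact fun h => h.2
    · exact fun h => ⟨by omega, h⟩
  · rw [h2, h1]; constructor
    · exact fun h => h.2.symm
    · exact fun h => ⟨by omega, h.symm⟩

def Gain (n k : ℕ) (L L' : List ℕ) : Prop := Psi n (Bd n L) + k ≤ Psi n (Bd n L')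

theorem gain_one {n : ℕ} {L L' : List ℕ} {a c : ℕ} (hp : Pres L L') (h : Adj a c)
    (ha : a ≤ n + 1) (hc : c ≤ n + 1) (hn : ¬ Con L a c) (hy : Con L' a c)
    (sa : a ∉ Sing n (Bd n L)) (sc : c ∉ Sing n (Bd n L)) : Gain n 3 L L' := by
  have h1 : min a c ∉ Bd n L := fun h' => hn ((min_mem h ha hc).1 h')
  have h2 : Psi n (Bd n L) + 3 ≤ Psi n (insert (min a c) (Bd n L)) := by
    apply psi_add3 h1
    · rcases min_cases h with ⟨h1, h2⟩ | ⟨h1, h2⟩ <;> rw [h1] <;> assumption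
    · rcases min_cases h with ⟨h1, h2⟩ | ⟨h1, h2⟩ <;> rw [h2] <;> assumption
  refine h2.trans (psi_mono (Finset.insert_subset ?_ (Bd_mono hp)))
  exact (min_mem h ha hc).2 hy

theorem gain_two {n b : ℕ} {L L' : List ℕ} {a c : ℕ} (hp : Pres L L')
    (hb : b ≤ n) (hbn : ¬ Con L b (b + 1)) (hby : Con L' b (b + 1)) (sb : b ∉ Sing n (Bd n L))
    (h : Adj a c) (ha : a ≤ n + 1) (hc : c ≤ n + 1) (hn : ¬ Con L a c) (hy : Con L' a c)
    (hab : b < a) (hcb : b < c) : Gain n 3 L L' := by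
  have h0 : b ∉ Bd n L := fun h' => hbn (mem_Bd.1 h').2
  have h1 : min a c ∉ insert b (Bd n L) := by
    rw [Finset.mem_insert]
    rintro (h' | h')
    · omega
    · exact hn ((min_mem h ha hc).1 h')
  have h2 := psi_add2 (n := n) h0 (Or.inl sb)
  have h3 := psi_add1 (n := n) h1
  have h4 : Psi n (insert (min a c) (insert b (Bd n L))) ≤ Psi n (Bd n L') := by
    apply psi_mono
    refine Finset.insert_subset ((min_mem h ha hc).2 hy) (Finset.insert_subset ?_ (Bd_mono hp))
    exact mem_Bd.2 ⟨hb, hby⟩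
  unfold Gain
  omega

theorem gain_three {n b : ℕ} {L L' : List ℕ} {q : ℕ} (hp : Pres L L')
    (hb : b ≤ n) (hbn : ¬ Con L b (b + 1)) (hby : Con L' b (b + 1)) (sb : b ∉ Sing n (Bd n L))
    (hq : q + 1 ≤ n) (hbq : b + 1 < q)
    (hn : ¬ Con L (q + 1) (q + 1 + 1)) (hy : Con L' (q + 1) (q + 1 + 1))
    (hn' : ¬ Con L q (q + 1)) (hy' : Con L' q (q + 1))
    (s1 : q ∉ Sing n (Bd n L)) (s2 : q + 1 + 1 ∉ Sing n (Bd n L)) : Gain n 6 L L' := by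
  have h0 : b ∉ Bd n L := fun h' => hbn (mem_Bd.1 h').2
  have h1 : q ∉ insert b (Bd n L) := by
    rw [Finset.mem_insert]
    rintro (h' | h')
    · omega
    · exact hn' (mem_Bd.1 h').2
  have h2 : q + 1 ∉ insert q (insert b (Bd n L)) := by
    simp only [Finset.mem_insert]
    rintro (h' | h' | h')
    · omega
    · omega
    · exact hn (mem_Bd.1 h').2
  have g0 := psi_add2 (n := n) h0 (Or.inl sb)
  have g1 := psi_add2 (n := n) h1 (Or.inl fun h => s1 (sing_anti (Finset.subset_insert _ _) h))
  have g2 := psi_add2 (n := n) h2 (Or.inr fun h => s2 (sing_anti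
    ((Finset.subset_insert _ _).trans (Finset.subset_insert _ _)) h))
  have h4 : Psi n (insert (q + 1) (insert q (insert b (Bd n L)))) ≤ Psi n (Bd n L') := by
    apply psi_mono
    refine Finset.insert_subset (mem_Bd.2 ⟨hq, hy⟩) (Finset.insert_subset (mem_Bd.2 ⟨by omega, hy'⟩)
      (Finset.insert_subset (mem_Bd.2 ⟨hb, hby⟩) (Bd_mono hp)))
  unfold Gain
  omega

def fr (n : ℕ) (l : List ℕ) : List ℕ := 0 :: (l ++ [n + 1])

structure Ctx (n b : ℕ) (A Q R : List ℕ) : Prop where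
  hbn : b + 1 ≤ n
  hA : A.getLast? = some b
  memA : ∀ v, v ∈ A ↔ v ≤ b
  hQ : ∀ v ∈ Q, b + 2 ≤ v ∧ v ≤ n
  hR : ∀ v ∈ R, b + 2 ≤ v ∧ v ≤ n
  hmem : ∀ v, b + 2 ≤ v → v ≤ n → v ∈ Q ∨ v ∈ R
  nd : (A ++ Q ++ (b + 1) :: (R ++ [n + 1])).Nodup
  sb : b ∉ Sing n (Bd n (A ++ Q ++ (b + 1) :: (R ++ [n + 1])))

theorem Ctx.disj {n b : ℕ} {A Q R : List ℕ} (c : Ctx n b A Q R) {v : ℕ} (h : v ∈ Q) : v ∉ R := by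
  intro h'
  have := c.nd
  rw [List.nodup_append] at this
  exact this.2.2 v (by simp [h]) v (by simp [h']) rfl

theorem Ctx.ndQ {n b : ℕ} {A Q R : List ℕ} (c : Ctx n b A Q R) : Q.Nodup := by
  have := c.nd
  rw [List.nodup_append, List.nodup_append] at this
  exact this.1.2.1

theorem Ctx.ndR {n b : ℕ} {A Q R : List ℕ} (c : Ctx n b A Q R) :
    ((b + 1) :: (R ++ [n + 1])).Nodup := by
  have := c.nd
  rw [List.nodup_append] at this
  exact this.2.1

/-- `b` and `b+1` are not consecutive -/
theorem Ctx.nb {n b : ℕ} {A Q R : List ℕ} (c : Ctx n b A Q R) (hQ : Q ≠ []) :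
    ¬ Con (A ++ Q ++ (b + 1) :: (R ++ [n + 1])) b (b + 1) := by
  intro h
  rcases nbr c.nd h.symm with h | h
  · obtain ⟨Q', z, rfl⟩ := List.eq_nil_or_concat Q |>.resolve_left hQ
    simp at h
    have := c.hQ z (by simp)
    omega
  · have := List.mem_of_mem_head? h
    simp at this
    rcases this with h | h
    · have := c.hR _ h; omega
    · have := c.hbn; omega

theorem Ctx.nq {n b q y : ℕ} {A Q R : List ℕ} (c : Ctx n b A (q :: Q) R) (hy : b < y)
    (hh : (Q ++ (b + 1) :: (R ++ [n + 1])).head? ≠ some y) :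
    ¬ Con (A ++ q :: Q ++ (b + 1) :: (R ++ [n + 1])) q y := by
  intro h
  have hnd := c.nd
  simp only [List.append_assoc, List.cons_append] at h hnd
  rcases nbr hnd h with h | h
  · rw [c.hA] at h; simp at h; omega
  · exact hh h

/-- cut `Q` and paste it between `R1` and `R2` -/
theorem face_right {n b q y : ℕ} {A Q R R1 R2 : List ℕ} (c : Ctx n b A (q :: Q) R)
    (h1 : NJ (q :: Q) [b + 1]) (hR : (b + 1) :: R = R1 ++ y :: R2) (hqy : Adj q y)
    (h2 : NJ [y] (R2 ++ [n + 1])) :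
    Gain n 3 (A ++ q :: Q ++ (b + 1) :: (R ++ [n + 1]))
      (A ++ (R1 ++ y :: (q :: Q ++ R2)) ++ [n + 1]) := by
  have hb := c.hbn
  have hq := c.hQ q (by simp)
  have hyR : y ∈ (b + 1) :: R := by rw [hR]; simp
  have hyb : b < y ∧ y ≤ n := by
    rcases List.mem_cons.1 hyR with rfl | h
    · omega
    · have := c.hR y h; omega
  have hyQ : y ∉ Q := by
    intro h
    rcases List.mem_cons.1 hyR with rfl | h'
    · have := c.hQ _ (List.mem_cons_of_mem _ h); omega
    · exact c.disj (List.mem_cons_of_mem _ h) h'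
  refine gain_two (b := b) (a := q) (c := y) ?_ (by omega) (c.nb (by simp)) ?_ c.sb hqy (by omega)
    (by omega) ?_ ?_ (by omega) (by omega)
  · have e : A ++ q :: Q ++ (b + 1) :: (R ++ [n + 1]) =
        A ++ (q :: Q ++ ((R1 ++ [y]) ++ (R2 ++ [n + 1]))) := by
      rw [← List.cons_append, hR]; simp
    rw [e]
    refine Pres.append (Pres.of_infix ⟨[], _, by simp; rfl⟩) (Pres.append
      (Pres.of_infix ⟨A ++ R1 ++ [y], R2 ++ [n + 1], by simp⟩) (Pres.append
      (Pres.of_infix ⟨A, q :: Q ++ R2 ++ [n + 1], by simp⟩)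
      (Pres.of_infix ⟨A ++ R1 ++ y :: q :: Q, [], by simp⟩) ?_) ?_) ?_
    · intro u v hj; exact h2 u v ⟨by simpa using hj.1, hj.2⟩
    · intro u v hj
      refine h1 u v ⟨hj.1, ?_⟩
      have := hj.2
      have e2 : (R1 ++ [y] ++ (R2 ++ [n + 1])) = (b + 1) :: (R ++ [n + 1]) := by
        rw [← List.cons_append, hR]; simp
      rw [e2] at this
      simpa using this
    · intro u v hj huv
      simp only [Jn, c.hA] at hj
      simp at hj
      unfold Adj at huv
      omega
  · have : Con (A ++ (R1 ++ y :: R2)) b (b + 1) := Con.of_jn ⟨c.hA, by rw [← hR]; simp⟩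
    have : Con (A ++ (R1 ++ [y])) b (b + 1) := Con.of_jn ⟨c.hA, by
      have : (R1 ++ y :: R2).head? = some (b + 1) := by rw [← hR]; simp
      cases R1 <;> simpa using this⟩
    exact this.mono ⟨[], q :: Q ++ R2 ++ [n + 1], by simp⟩
  · apply c.nq hyb.1
    intro h
    cases Q with
    | nil => 
      simp at h
      have := h1 q (b + 1) (by simp [Jn])
      rw [h] at this; exact this hqy
    | cons z Q => simp at h; subst h; simp at hyQ
  · exact Or.inr ⟨A ++ R1, Q ++ R2 ++ [n + 1], by simp⟩

theorem face_left {n b q y : ℕ} {A Q R R1 R2 : List ℕ} (c : Ctx n b A (q :: Q) R)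
    (h1 : NJ (q :: Q) [b + 1]) (hR : (b + 1) :: R = (b + 1) :: R1 ++ R2) (hqy : Adj q y)
    (hy : (R2 ++ [n + 1]).head? = some y) (h2 : NJ ((b + 1) :: R1) (R2 ++ [n + 1])) :
    Gain n 3 (A ++ q :: Q ++ (b + 1) :: (R ++ [n + 1]))
      (A ++ ((b + 1) :: R1 ++ ((q :: Q).reverse ++ R2)) ++ [n + 1]) := by
  have hb := c.hbn
  have hq := c.hQ q (by simp)
  have hR' : R = R1 ++ R2 := by simpa using hR
  have hyR : y ∈ R ++ [n + 1] := by
    have := List.mem_of_mem_head? hy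
    rw [hR']; simp at this ⊢; tauto
  have hyb : b + 1 < y ∧ y ≤ n + 1 := by
    rcases List.mem_append.1 hyR with h | h
    · have := c.hR y h; omega
    · simp at h; omega
  have hyQ : y ∉ Q := by
    intro h
    have := c.hQ _ (List.mem_cons_of_mem _ h)
    rcases List.mem_append.1 hyR with h' | h'
    · exact c.disj (List.mem_cons_of_mem _ h) h'
    · simp at h'; omega
  refine gain_two (b := b) (a := q) (c := y) ?_ (by omega) (c.nb (by simp)) ?_ c.sb hqy (by omega)
    (by omega) ?_ ?_ (by omega) (by omega)
  · have e : A ++ q :: Q ++ (b + 1) :: (R ++ [n + 1]) =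
        A ++ (q :: Q ++ (((b + 1) :: R1) ++ (R2 ++ [n + 1]))) := by
      rw [hR']; simp
    rw [e]
    refine Pres.append (Pres.of_infix ⟨[], _, by simp; rfl⟩) (Pres.append
      (Pres.of_rev ⟨A ++ (b + 1) :: R1, R2 ++ [n + 1], by simp⟩) (Pres.append
      (Pres.of_infix ⟨A, (q :: Q).reverse ++ R2 ++ [n + 1], by simp⟩)
      (Pres.of_infix ⟨A ++ (b + 1) :: R1 ++ (q :: Q).reverse, [], by simp⟩) h2) ?_) ?_
    · intro u v hj
      exact h1 u v ⟨hj.1, by simpa using hj.2⟩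
    · intro u v hj huv
      simp only [Jn, c.hA] at hj
      simp at hj
      unfold Adj at huv
      omega
  · have : Con (A ++ [b + 1]) b (b + 1) := Con.of_jn ⟨c.hA, by simp⟩
    exact this.mono ⟨[], R1 ++ (q :: Q).reverse ++ R2 ++ [n + 1], by simp⟩
  · apply c.nq (by omega)
    intro h
    cases Q with
    | nil => simp at h; omega
    | cons z Q => simp at h; subst h; simp at hyQ
  · have : Con ((q :: Q).reverse ++ (R2 ++ [n + 1])) q y := Con.of_jn ⟨by simp, hy⟩
    exact this.mono ⟨A ++ (b + 1) :: R1, [], by simp⟩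

/-- partner of `q` left-exposed in `Q` -/
theorem left_in {n b q y : ℕ} {A Q1 Q2 R : List ℕ} (c : Ctx n b A (q :: Q1 ++ y :: Q2) R)
    (h1 : NJ [b + 1] (R ++ [n + 1])) (hqy : Adj q y) (h2 : NJ (q :: Q1) [y]) :
    Gain n 3 (A ++ (q :: Q1 ++ y :: Q2) ++ (b + 1) :: (R ++ [n + 1]))
      (A ++ ((y :: Q2 ++ [b + 1]).reverse ++ (q :: Q1 ++ R)) ++ [n + 1]) := by
  have hb := c.hbn
  have hq := c.hQ q (by simp)
  have hy := c.hQ y (by simp)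
  refine gain_two (b := b) (a := q) (c := y) ?_ (by omega) (c.nb (by simp)) ?_ c.sb hqy (by omega)
    (by omega) ?_ ?_ (by omega) (by omega)
  · have e : A ++ (q :: Q1 ++ y :: Q2) ++ (b + 1) :: (R ++ [n + 1]) =
        A ++ (q :: Q1 ++ ((y :: Q2 ++ [b + 1]) ++ (R ++ [n + 1]))) := by simp
    rw [e]
    refine Pres.append (Pres.of_infix ⟨[], _, by simp; rfl⟩) (Pres.append
      (Pres.of_infix ⟨A ++ (y :: Q2 ++ [b + 1]).reverse, R ++ [n + 1], by simp⟩) (Pres.append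
      (Pres.of_rev ⟨A, q :: Q1 ++ R ++ [n + 1], by simp⟩)
      (Pres.of_infix ⟨A ++ (y :: Q2 ++ [b + 1]).reverse ++ q :: Q1, [], by simp⟩) ?_) ?_) ?_
    · intro u v hj
      refine h1 u v ⟨?_, hj.2⟩
      have := hj.1
      rw [List.getLast?_append] at this
      simpa using this
    · intro u v hj
      exact h2 u v ⟨hj.1, by simpa using hj.2⟩
    · intro u v hj huv
      simp only [Jn, c.hA] at hj
      simp at hj
      unfold Adj at huv
      omega
  · have : Con (A ++ [b + 1]) b (b + 1) := Con.of_jn ⟨c.hA, by simp⟩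
    exact this.mono ⟨[], (y :: Q2).reverse ++ q :: Q1 ++ R ++ [n + 1], by simp⟩
  · have c' : Ctx n b A (q :: (Q1 ++ y :: Q2)) R := c
    have := c'.nq (y := y) (by omega)
    apply this
    intro h
    cases Q1 with
    | nil => exact h2 q y (by simp [Jn]) hqy
    | cons z Q1 =>
      simp at h; subst h
      have := c.ndQ
      simp at this
  · exact Or.inr ⟨A ++ [b + 1] ++ Q2.reverse, Q1 ++ R ++ [n + 1], by simp⟩

/-- both `q` and `y` in strips -/
theorem strip_strip {n b q q' y w : ℕ} {A F G Q2 R : List ℕ}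
    (c : Ctx n b A (q :: q' :: F ++ G ++ Q2) R) (hqy : Adj q y) (hqq : Adj q q')
    (hG : G.getLast? = some y) (hwy : Adj w y)
    (hw : Con (q :: q' :: F ++ G) w y) (hyq : y ≠ q')
    (h1 : NJ (q' :: F) G) (h2 : NJ [y] (Q2 ++ [b + 1])) :
    Gain n 3 (A ++ (q :: q' :: F ++ G ++ Q2) ++ (b + 1) :: (R ++ [n + 1]))
      (A ++ (G ++ (q :: q' :: F ++ (Q2 ++ (b + 1) :: R))) ++ [n + 1]) := by
  have hb := c.hbn
  have hq := c.hQ q (by simp)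
  have hy := c.hQ y (by simp [List.mem_of_mem_getLast? hG])
  refine gain_one (a := q) (c := y) ?_ hqy (by omega) (by omega) ?_ ?_ ?_ ?_
  · have e : A ++ (q :: q' :: F ++ G ++ Q2) ++ (b + 1) :: (R ++ [n + 1]) =
        A ++ (q :: q' :: F ++ (G ++ (Q2 ++ (b + 1) :: (R ++ [n + 1])))) := by simp
    rw [e]
    refine Pres.append (Pres.of_infix ⟨[], _, by simp; rfl⟩) (Pres.append
      (Pres.of_infix ⟨A ++ G, Q2 ++ (b + 1) :: (R ++ [n + 1]), by simp⟩) (Pres.append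
      (Pres.of_infix ⟨A, q :: q' :: F ++ (Q2 ++ (b + 1) :: (R ++ [n + 1])), by simp⟩)
      (Pres.of_infix ⟨A ++ G ++ q :: q' :: F, [], by simp⟩) ?_) ?_) ?_
    · intro u v hj
      refine h2 u v ⟨?_, ?_⟩
      · have := hj.1
        rw [hG] at this
        simpa using this
      · have := hj.2
        cases Q2 <;> simpa using this
    · intro u v hj
      refine h1 u v ⟨by simpa [Jn] using hj.1, ?_⟩
      have := hj.2
      cases G with
      | nil => simp at hG
      | cons => simpa using this
    · intro u v hj huv
      simp only [Jn, c.hA] at hj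
      simp at hj
      unfold Adj at huv
      omega
  · have c' : Ctx n b A (q :: (q' :: F ++ G ++ Q2)) R := by simpa using c
    have := c'.nq (y := y) (by omega) (by simpa using fun h => hyq h.symm)
    simpa using this
  · have : Con (G ++ [q]) y q := Con.of_jn ⟨hG, by simp⟩
    exact this.symm.mono ⟨A, q' :: F ++ (Q2 ++ (b + 1) :: R) ++ [n + 1], by simp⟩
  · refine not_sing hqq (Or.inl ⟨A, F ++ G ++ Q2 ++ (b + 1) :: (R ++ [n + 1]), by simp⟩)
  · refine not_sing hwy.symm (hw.symm.mono ⟨A, Q2 ++ (b + 1) :: (R ++ [n + 1]), by simp⟩)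

theorem nj_A {n b : ℕ} {A Q R T : List ℕ} (c : Ctx n b A Q R) (hT : ∀ v, T.head? = some v → b + 1 < v) :
    NJ A T := by
  intro u v hj huv
  have h1 := hj.1
  rw [c.hA] at h1
  simp at h1
  have := hT v hj.2
  unfold Adj at huv
  omega

/-- last element of `Q` is bonded to `b+1` -/
theorem case_a1 {n b z : ℕ} {A Q R : List ℕ} (c : Ctx n b A Q R)
    (hz : Q.getLast? = some z) (hzx : Adj z (b + 1)) :
    Gain n 3 (A ++ Q ++ (b + 1) :: (R ++ [n + 1]))
      (A ++ ((Q ++ [b + 1]).reverse ++ R) ++ [n + 1]) := by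
  have hb := c.hbn
  have hzQ := List.mem_of_mem_getLast? hz
  have hz2 := c.hQ z hzQ
  have hQ0 : Q ≠ [] := by rintro rfl; simp at hz
  refine gain_one (a := b) (c := b + 1) ?_ (Or.inl rfl) (by omega) (by omega) (c.nb hQ0) ?_ c.sb ?_
  · have e : A ++ Q ++ (b + 1) :: (R ++ [n + 1]) =
        A ++ ((Q ++ [b + 1]) ++ (R ++ [n + 1])) := by simp
    rw [e]
    refine Pres.append (Pres.of_infix ⟨[], _, by simp; rfl⟩) (Pres.append
      (Pres.of_rev ⟨A, R ++ [n + 1], by simp⟩)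
      (Pres.of_infix ⟨A ++ (Q ++ [b + 1]).reverse, [], by simp⟩) ?_) ?_
    · intro u v hj huv
      have h1 := hj.1
      rw [List.getLast?_append] at h1
      simp at h1
      have h2 := List.mem_of_mem_head? hj.2
      have hv : v = z := by
        have : b + 2 ≤ v := by
          rcases List.mem_append.1 h2 with h | h
          · exact (c.hR v h).1
          · simp at h; omega
        unfold Adj at huv hzx
        omega
      subst hv
      rcases List.mem_append.1 h2 with h | h
      · exact c.disj hzQ h
      · simp at h; omega
    · apply nj_A c
      intro v hv
      have : Q.head? = some v := by cases Q <;> simp_all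
      have := c.hQ v (List.mem_of_mem_head? this)
      omega
  · have : Con (A ++ [b + 1]) b (b + 1) := Con.of_jn ⟨c.hA, by simp⟩
    exact this.mono ⟨[], Q.reverse ++ R ++ [n + 1], by simp⟩
  · refine not_sing hzx.symm ?_
    have : Con (Q ++ [b + 1]) z (b + 1) := Con.of_jn ⟨hz, by simp⟩
    exact this.symm.mono ⟨A, R ++ [n + 1], by simp⟩

theorem case_a2 {n b r : ℕ} {A Q R T1 T2 : List ℕ} (c : Ctx n b A Q R) (hQ0 : Q ≠ [])
    (h1 : NJ Q [b + 1]) (hr : (R ++ [n + 1]).head? = some r) (hxr : Adj (b + 1) r)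
    (hR : (b + 1) :: R = T1 ++ T2) (hT1 : T1.head? = some (b + 1)) (h2 : NJ T1 (T2 ++ [n + 1])) :
    Gain n 3 (A ++ Q ++ (b + 1) :: (R ++ [n + 1]))
      (A ++ (T1 ++ (Q ++ T2)) ++ [n + 1]) := by
  have hb := c.hbn
  refine gain_one (a := b) (c := b + 1) ?_ (Or.inl rfl) (by omega) (by omega) (c.nb hQ0) ?_ c.sb ?_
  · have e : A ++ Q ++ (b + 1) :: (R ++ [n + 1]) =
        A ++ (Q ++ (T1 ++ (T2 ++ [n + 1]))) := by
      rw [← List.cons_append, hR]; simp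
    rw [e]
    refine Pres.append (Pres.of_infix ⟨[], _, by simp; rfl⟩) (Pres.append
      (Pres.of_infix ⟨A ++ T1, T2 ++ [n + 1], by simp⟩) (Pres.append
      (Pres.of_infix ⟨A, Q ++ T2 ++ [n + 1], by simp⟩)
      (Pres.of_infix ⟨A ++ T1 ++ Q, [], by simp⟩) h2) ?_) ?_
    · intro u v hj
      refine h1 u v ⟨hj.1, ?_⟩
      have := hj.2
      cases T1 <;> simp_all
    · apply nj_A c
      intro v hv
      have : Q.head? = some v := by cases Q <;> simp_all
      have := c.hQ v (List.mem_of_mem_head? this)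
      omega
  · have : Con (A ++ T1) b (b + 1) := Con.of_jn ⟨c.hA, hT1⟩
    exact this.mono ⟨[], Q ++ T2 ++ [n + 1], by simp⟩
  · refine not_sing hxr ?_
    have : Con ([b + 1] ++ (R ++ [n + 1])) (b + 1) r := Con.of_jn ⟨by simp, hr⟩
    exact this.mono ⟨A ++ Q, [], by simp⟩

theorem case_two {n b q y1 y2 w1 w2 : ℕ} {A A1 A2 W R : List ℕ}
    (c : Ctx n b A (q :: A1 ++ A2 ++ W) R)
    (hx : NJ [b + 1] (R ++ [n + 1])) (hl : NJ (q :: A1 ++ A2 ++ W) [b + 1])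
    (hq : NJ [q] A1) (h12 : NJ A1 A2) (h2 : NJ A2 (W ++ [b + 1]))
    (hy1 : A1.getLast? = some y1) (hy2 : A2.getLast? = some y2)
    (hq1 : Adj q y1) (hq2 : Adj q y2) (hne : y1 ≠ y2)
    (hw1 : Adj y1 w1) (hw2 : Adj y2 w2) (hc1 : Con A1 y1 w1) (hc2 : Con A2 y2 w2) :
    Gain n 6 (A ++ (q :: A1 ++ A2 ++ W) ++ (b + 1) :: (R ++ [n + 1]))
      (A ++ ((b + 1) :: (W.reverse ++ A1 ++ q :: A2.reverse ++ R)) ++ [n + 1])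
    ∧ Psi n (Bd n (A ++ (q :: A1 ++ A2 ++ W) ++ (b + 1) :: (R ++ [n + 1]))) + 6 ≤ 3 * n := by
  have hb := c.hbn
  have hqn := c.hQ q (by simp)
  have hy1n := c.hQ y1 (by simp [List.mem_of_mem_getLast? hy1])
  have hy2n := c.hQ y2 (by simp [List.mem_of_mem_getLast? hy2])
  have hA1 : A1 ≠ [] := by rintro rfl; simp at hy1
  have hA2 : A2 ≠ [] := by rintro rfl; simp at hy2
  set L := A ++ (q :: A1 ++ A2 ++ W) ++ (b + 1) :: (R ++ [n + 1]) with hL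
  set L' := A ++ ((b + 1) :: (W.reverse ++ A1 ++ q :: A2.reverse ++ R)) ++ [n + 1] with hL'
  have P : Pres L L' := by
    have e : L = A ++ ([q] ++ (A1 ++ (A2 ++ ((W ++ [b + 1]) ++ (R ++ [n + 1]))))) := by simp [hL]
    rw [e]
    refine Pres.append (Pres.of_infix ⟨[], _, by simp [hL']; rfl⟩) (Pres.append
      (Pres.of_infix ⟨A ++ (b + 1) :: W.reverse ++ A1, A2.reverse ++ R ++ [n + 1], by simp [hL']⟩)
      (Pres.append
      (Pres.of_infix ⟨A ++ (b + 1) :: W.reverse, q :: A2.reverse ++ R ++ [n + 1], by simp [hL']⟩)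
      (Pres.append
      (Pres.of_rev ⟨A ++ (b + 1) :: W.reverse ++ A1 ++ [q], R ++ [n + 1], by simp [hL']⟩)
      (Pres.append
      (Pres.of_rev ⟨A, A1 ++ q :: A2.reverse ++ R ++ [n + 1], by simp [hL']⟩)
      (Pres.of_infix ⟨A ++ (b + 1) :: W.reverse ++ A1 ++ q :: A2.reverse, [], by simp [hL']⟩)
      ?_) ?_) ?_) ?_) ?_
    · intro u v hj
      refine hx u v ⟨?_, hj.2⟩
      have := hj.1
      rw [List.getLast?_append] at this
      simpa using this
    · intro u v hj
      refine h2 u v ⟨hj.1, ?_⟩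
      have := hj.2
      cases W <;> simpa using this
    · intro u v hj
      refine h12 u v ⟨hj.1, ?_⟩
      have := hj.2
      cases A2 <;> simp_all
    · intro u v hj
      refine hq u v ⟨hj.1, ?_⟩
      have := hj.2
      cases A1 <;> simp_all
    · apply nj_A c
      intro v hv
      simp at hv; omega
  have hnb : ¬ Con L b (b + 1) := c.nb (by simp)
  have hby : Con L' b (b + 1) := by
    have : Con (A ++ [b + 1]) b (b + 1) := Con.of_jn ⟨c.hA, by simp⟩
    exact this.mono ⟨[], W.reverse ++ A1 ++ q :: A2.reverse ++ R ++ [n + 1], by simp [hL']⟩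
  have c' : Ctx n b A (q :: (A1 ++ A2 ++ W)) R := by simpa using c
  have hn : ∀ y, b < y → Adj q y → ¬ Con L q y := by
    intro y hy hqy hC
    have := c'.nq (y := y) hy ?_
    · apply this; simpa [hL] using hC
    · intro h
      refine hq q y ⟨by simp, ?_⟩ hqy
      cases A1 <;> simp_all
  have hC1 : Con L' q y1 := by
    have : Con (A1 ++ [q]) y1 q := Con.of_jn ⟨hy1, by simp⟩
    exact this.symm.mono ⟨A ++ (b + 1) :: W.reverse, A2.reverse ++ R ++ [n + 1], by simp [hL']⟩
  have hC2 : Con L' q y2 := by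
    have : Con ([q] ++ A2.reverse) q y2 := Con.of_jn ⟨by simp, by simpa using hy2⟩
    exact this.mono ⟨A ++ (b + 1) :: W.reverse ++ A1, R ++ [n + 1], by simp [hL']⟩
  have s1 : y1 ∉ Sing n (Bd n L) :=
    not_sing hw1 (hc1.mono ⟨A ++ [q], A2 ++ W ++ (b + 1) :: (R ++ [n + 1]), by simp [hL]⟩)
  have s2 : y2 ∉ Sing n (Bd n L) :=
    not_sing hw2 (hc2.mono ⟨A ++ q :: A1, W ++ (b + 1) :: (R ++ [n + 1]), by simp [hL]⟩)
  have key : ∃ p, q = p + 1 ∧ b + 1 < p ∧ Con L' p (p + 1) ∧ Con L' (p + 1) (p + 1 + 1) ∧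
      p ∉ Sing n (Bd n L) ∧ p + 1 + 1 ∉ Sing n (Bd n L) := by
    obtain ⟨p, rfl⟩ : ∃ p, q = p + 1 := ⟨q - 1, by omega⟩
    refine ⟨p, rfl, ?_⟩
    unfold Adj at hq1 hq2
    rcases hq1 with h | h <;> rcases hq2 with h' | h'
    · omega
    · obtain rfl : y2 = p := by omega
      subst h
      exact ⟨by omega, hC2.symm, hC1, s2, s1⟩
    · obtain rfl : y1 = p := by omega
      subst h'
      exact ⟨by omega, hC1.symm, hC2, s1, s2⟩
    · omega
  obtain ⟨p, rfl, hbp, k1, k2, k3, k4⟩ := key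
  have hn1 := hn p (by omega) (Or.inr rfl)
  have hn2 := hn (p + 1 + 1) (by omega) (Or.inl rfl)
  refine ⟨gain_three P (by omega) hnb hby c.sb (by omega) hbp hn2 k2 (fun h => hn1 h.symm) k1 k3 k4, ?_⟩
  have hx1 : ¬ Con L (b + 1) (b + 1 + 1) := by
    intro h
    rcases nbr (hL ▸ c.nd) h with h | h
    · refine hl (b + 1 + 1) (b + 1) ⟨?_, by simp⟩ (Or.inr rfl)
      rw [List.getLast?_append, List.cons_append, List.cons_append,
        List.getLast?_cons] at h
      rw [List.cons_append, List.cons_append, List.getLast?_cons]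
      simpa using h
    · exact hx (b + 1) (b + 1 + 1) ⟨by simp, h⟩ (Or.inl rfl)
  have hD : ({b, b + 1, p, p + 1} : Finset ℕ) ⊆ Finset.range (n + 1) \ Bd n L := by
    intro v hv
    simp only [Finset.mem_insert, Finset.mem_singleton] at hv
    rw [Finset.mem_sdiff, mem_Bd, Finset.mem_range]
    rcases hv with rfl | rfl | rfl | rfl
    · exact ⟨by omega, fun h => hnb h.2⟩
    · exact ⟨by omega, fun h => hx1 h.2⟩
    · exact ⟨by omega, fun h => hn1 h.2.symm⟩
    · exact ⟨by omega, fun h => hn2 h.2⟩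
  have hcard : 4 ≤ ({b, b + 1, p, p + 1} : Finset ℕ).card := by
    rw [Finset.card_insert_of_notMem, Finset.card_insert_of_notMem, Finset.card_insert_of_notMem,
      Finset.card_singleton] <;> simp <;> omega
  have := psi_le_of_missing Bd_sub hD hcard (by omega)
  omega

theorem not_both {n z : ℕ} {A T : List ℕ} (nd : (A ++ z :: T).Nodup) (hz : 1 ≤ z)
    (h : (∀ y, A.getLast? = some y → ¬ Adj z y) ∨ (∀ y, T.head? = some y → ¬ Adj z y)) :
    z ∉ Bd n (A ++ z :: T) ∨ z - 1 ∉ Bd n (A ++ z :: T) := by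
  by_contra hcon
  push Not at hcon
  obtain ⟨h1, h2⟩ := hcon
  have h1 := (mem_Bd.1 h1).2
  have h2 := (mem_Bd.1 h2).2.symm
  rw [Nat.sub_add_cancel hz] at h2
  have a1 : Adj z (z + 1) := Or.inl rfl
  have a2 : Adj z (z - 1) := Or.inr (by omega)
  rcases h with h | h
  · have e1 := (nbr nd h1).resolve_left (fun h' => h _ h' a1)
    have e2 := (nbr nd h2).resolve_left (fun h' => h _ h' a2)
    rw [e1] at e2
    simp at e2; omega
  · have e1 := (nbr nd h1).resolve_right (fun h' => h _ h' a1)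
    have e2 := (nbr nd h2).resolve_right (fun h' => h _ h' a2)
    rw [e1] at e2
    simp at e2; omega

theorem Ctx.nbq {n b q : ℕ} {A Q R : List ℕ} (c : Ctx n b A (q :: Q) R) :
    q ∉ Bd n (A ++ q :: Q ++ (b + 1) :: (R ++ [n + 1])) ∨
    q - 1 ∉ Bd n (A ++ q :: Q ++ (b + 1) :: (R ++ [n + 1])) := by
  have hq := c.hQ q (by simp)
  have e : A ++ q :: Q ++ (b + 1) :: (R ++ [n + 1]) = A ++ q :: (Q ++ (b + 1) :: (R ++ [n + 1])) := by
    simp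
  have nd := c.nd
  rw [e] at nd ⊢
  refine not_both nd (by omega) (Or.inl ?_)
  intro y hy
  rw [c.hA] at hy
  simp at hy
  unfold Adj; omega

theorem bound_a {n b q : ℕ} {A Q R : List ℕ} (c : Ctx n b A (q :: Q) R)
    (h : Con (A ++ q :: Q ++ (b + 1) :: (R ++ [n + 1])) (b + 1) (b + 1 + 1)) :
    Psi n (Bd n (A ++ q :: Q ++ (b + 1) :: (R ++ [n + 1]))) + 3 ≤ 3 * n := by
  have hq := c.hQ q (by simp)
  have hb0 : b ∉ Bd n (A ++ q :: Q ++ (b + 1) :: (R ++ [n + 1])) :=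
    fun h => c.nb (by simp) (mem_Bd.1 h).2
  have hb1 := mem_Bd.2 ⟨c.hbn, h⟩
  rcases c.nbq with h' | h'
  · exact psi_le_of_two Bd_sub hb0 hb1 h' (by omega) (by omega)
  · exact psi_le_of_two Bd_sub hb0 hb1 h' (by omega) (by omega)

theorem bound_b {n b q : ℕ} {A Q R : List ℕ} (c : Ctx n b A (q :: Q) R)
    (h1 : NJ (q :: Q) [b + 1]) (hx : NJ [b + 1] (R ++ [n + 1])) :
    Psi n (Bd n (A ++ q :: Q ++ (b + 1) :: (R ++ [n + 1]))) + 3 ≤ 3 * n := by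
  have hq := c.hQ q (by simp)
  set L := A ++ q :: Q ++ (b + 1) :: (R ++ [n + 1]) with hL
  have hb0 : b ∉ Bd n L :=
    fun h => c.nb (by simp) (mem_Bd.1 h).2
  have hb1 : b + 1 ∉ Bd n L := by
    intro h
    rcases nbr (hL ▸ c.nd) (mem_Bd.1 h).2 with h | h
    · refine h1 (b + 1 + 1) (b + 1) ⟨?_, by simp⟩ (Or.inr rfl)
      rw [List.getLast?_append, List.getLast?_cons] at h
      rw [List.getLast?_cons]
      simpa using h
    · exact hx (b + 1) (b + 1 + 1) ⟨by simp, h⟩ (Or.inl rfl)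
  suffices hd : ∃ d, b + 2 ≤ d ∧ d ≤ n ∧ d ∉ Bd n L by
    obtain ⟨d, hd1, hd2, hd3⟩ := hd
    have hD : ({b, b + 1, d} : Finset ℕ) ⊆ Finset.range (n + 1) \ Bd n L := by
      intro v hv
      simp only [Finset.mem_insert, Finset.mem_singleton] at hv
      rw [Finset.mem_sdiff, Finset.mem_range]
      rcases hv with rfl | rfl | rfl
      · exact ⟨by omega, hb0⟩
      · exact ⟨by omega, hb1⟩
      · exact ⟨by omega, hd3⟩
    have hcard : 3 ≤ ({b, b + 1, d} : Finset ℕ).card := by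
      rw [Finset.card_insert_of_notMem, Finset.card_insert_of_notMem,
        Finset.card_singleton] <;> simp <;> omega
    have := psi_le_of_missing Bd_sub hD hcard (by omega)
    omega
  by_cases hqB : q ∈ Bd n L
  · have hq1 := c.nbq.resolve_left (fun h => h hqB)
    by_cases hq3 : b + 3 ≤ q
    · exact ⟨q - 1, by omega, by omega, hq1⟩
    · rcases List.eq_nil_or_concat Q with rfl | ⟨Q', z, rfl⟩
      · exfalso
        exact h1 q (b + 1) (by simp [Jn]) (by unfold Adj; omega)
      · have hz := c.hQ z (by simp)
        have hzq : z ≠ q := by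
          rintro rfl
          have := c.ndQ
          simp at this
        have e : L = (A ++ q :: Q') ++ z :: ((b + 1) :: (R ++ [n + 1])) := by simp [hL]
        have nd := c.nd
        rw [← hL] at nd
        have := not_both (n := n) (e ▸ nd) (by omega) (Or.inr (by
          intro y hy hzy
          simp at hy
          subst hy
          refine h1 z (b + 1) ⟨?_, by simp⟩ hzy
          rw [List.concat_eq_append, ← List.cons_append]
          rw [List.getLast?_append]; simp))
        rw [← e] at this
        rcases this with h | h
        · exact ⟨z, by omega, by omega, h⟩
        · exact ⟨z - 1, by omega, by omega, h⟩
  · exact ⟨q, by omega, by omega, hqB⟩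

theorem not_NJ {A B : List ℕ} (h : ¬ NJ A B) : ∃ a b, A.getLast? = some a ∧ B.head? = some b ∧ Adj a b := by
  unfold NJ at h
  push Not at h
  obtain ⟨a, b, h1, h2⟩ := h
  exact ⟨a, b, h1.1, h1.2, h2⟩

theorem third {y a b c : ℕ} (h1 : Adj a y) (h2 : Adj b y) (h3 : Adj c y) (hab : a ≠ b) (hac : a ≠ c) :
    b = c := by
  unfold Adj at *; omega

theorem one_partner {n b q y : ℕ} {A Q R : List ℕ} (c : Ctx n b A (q :: Q) R)
    (h1 : NJ (q :: Q) [b + 1]) (hx : NJ [b + 1] (R ++ [n + 1])) (hqy : Adj q y)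
    (hh : Q.head? ≠ some y) :
    (∃ T, IsMove (q :: Q ++ (b + 1) :: R) T ∧
      Gain n 3 (A ++ q :: Q ++ (b + 1) :: (R ++ [n + 1])) (A ++ T ++ [n + 1])) ∨
    (∃ Q1 Q2 w, Q = Q1 ++ y :: Q2 ∧ Q1.getLast? = some w ∧ Adj w y ∧ NJ [y] (Q2 ++ [b + 1])) := by
  have hq := c.hQ q (by simp)
  have hb := c.hbn
  have hqR : q ∉ R := c.disj (by simp)
  have hloc : y = b + 1 ∨ y = n + 1 ∨ y ∈ R ∨ y ∈ Q := by
    by_cases hy1 : y = b + 1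
    · tauto
    by_cases hy2 : y = n + 1
    · tauto
    have := c.hmem y (by unfold Adj at hqy; omega) (by unfold Adj at hqy; omega)
    rcases this with h | h
    · rcases List.mem_cons.1 h with rfl | h
      · unfold Adj at hqy; omega
      · tauto
    · tauto
  rcases hloc with rfl | rfl | hy | hy
  · left
    refine ⟨_, ?_, face_right (R1 := []) (R2 := R) c h1 (by simp) hqy hx⟩
    exact ⟨[], q :: Q, (b + 1) :: R, [b + 1], R, by simp, by simp, Or.inl (by simp)⟩
  · left
    refine ⟨_, ?_, face_left (R1 := R) (R2 := []) c h1 (by simp) hqy (by simp) ?_⟩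
    · exact ⟨[], q :: Q, (b + 1) :: R, (b + 1) :: R, [], by simp, by simp, Or.inr (by simp)⟩
    · intro u v hj huv
      have h2 := hj.2
      simp at h2
      subst h2
      have := List.mem_of_mem_getLast? hj.1
      have huq : u = q := by
        rcases List.mem_cons.1 this with rfl | h
        · unfold Adj at hqy huv; omega
        · have := c.hR u h
          unfold Adj at hqy huv; omega
      subst huq
      rcases List.mem_cons.1 this with rfl | h
      · omega
      · exact hqR h
  · left
    obtain ⟨R1, R2, rfl⟩ := List.append_of_mem hy
    by_cases hl : NJ ((b + 1) :: R1) (y :: R2 ++ [n + 1])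
    · refine ⟨_, ?_, face_left (R1 := R1) (R2 := y :: R2) c h1 (by simp) hqy (by simp) hl⟩
      exact ⟨[], q :: Q, (b + 1) :: (R1 ++ y :: R2), (b + 1) :: R1, y :: R2, by simp, by simp,
        Or.inr (by simp)⟩
    · obtain ⟨z, y', hz, hy', hzy⟩ := not_NJ hl
      simp at hy'
      subst hy'
      refine ⟨_, ?_, face_right (R1 := (b + 1) :: R1) (R2 := R2) c h1 (by simp) hqy ?_⟩
      · exact ⟨[], q :: Q, (b + 1) :: (R1 ++ y :: R2), (b + 1) :: R1 ++ [y], R2, by simp, by simp,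
          Or.inl (by simp)⟩
      · intro u v hj huv
        have h2 := hj.1
        simp at h2
        subst h2
        have hv := List.mem_of_mem_head? hj.2
        have hzm := List.mem_of_mem_getLast? hz
        have hqz : q ≠ z := by
          rintro rfl
          rcases List.mem_cons.1 hzm with rfl | h
          · omega
          · exact hqR (by simp [h])
        have hqv : q ≠ v := by
          rintro rfl
          rcases List.mem_append.1 hv with h | h
          · exact hqR (by simp [h])
          · simp at h; omega
        have := third hqy hzy huv.symm hqz hqv
        subst this
        have nd := c.ndR
        have e : (b + 1) :: (R1 ++ y :: R2 ++ [n + 1]) = ((b + 1) :: R1) ++ y :: (R2 ++ [n + 1]) := by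
          simp
        rw [e, List.nodup_append] at nd
        exact nd.2.2 z hzm z (by simp at hv ⊢; tauto) rfl
  · obtain ⟨Q1, Q2, rfl⟩ := List.append_of_mem hy
    by_cases hl : NJ (q :: Q1) [y]
    · left
      refine ⟨_, ?_, left_in c hx hqy hl⟩
      exact ⟨q :: Q1, y :: Q2 ++ [b + 1], R, [], q :: Q1 ++ R, by simp, by simp, Or.inr (by simp)⟩
    · right
      obtain ⟨w, y', hw, hy', hwy⟩ := not_NJ hl
      simp at hy'
      subst hy'
      have hQ1 : Q1 ≠ [] := by
        rintro rfl
        simp at hh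
      have hw' : Q1.getLast? = some w := by
        cases Q1 with
        | nil => simp at hQ1
        | cons => simpa using hw
      refine ⟨Q1, Q2, w, rfl, hw', hwy, ?_⟩
      intro u v hj huv
      have h2 := hj.1
      simp at h2
      subst h2
      have hv := List.mem_of_mem_head? hj.2
      have hwm := List.mem_of_mem_getLast? hw'
      have hwn := c.hQ w (by simp [hwm])
      have nd := c.ndQ
      have hqw : q ≠ w := by
        rintro rfl
        simp [hwm] at nd
      have hqv : q ≠ v := by
        rintro rfl
        rcases List.mem_append.1 hv with h | h
        · simp [h] at nd
        · simp at h; omega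
      have := third hqy hwy huv.symm hqw hqv
      subst this
      rcases List.mem_append.1 hv with h | h
      · rw [List.nodup_cons, List.nodup_append] at nd
        exact nd.2.2.2 w hwm w (by simp [h]) rfl
      · simp at h; omega

theorem append_uniq {y : ℕ} {a b a' b' : List ℕ} (nd : (a ++ y :: b).Nodup)
    (h : a ++ y :: b = a' ++ y :: b') : a = a' ∧ b = b' := by
  induction a generalizing a' with
  | nil =>
    cases a' with
    | nil => simpa using h
    | cons z a' =>
      simp at h
      obtain ⟨rfl, rfl⟩ := h
      simp at nd
  | cons z a ih =>
    cases a' with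
    | nil =>
      simp at h
      obtain ⟨rfl, rfl⟩ := h
      simp at nd
    | cons z' a' =>
      simp only [List.cons_append, List.cons.injEq] at h
      obtain ⟨rfl, h⟩ := h
      have := ih (List.nodup_cons.1 nd).2 h
      simp [this]

theorem two_moves {n b q y1 y2 w1 w2 : ℕ} {A Q1 Q2 Q3 R : List ℕ}
    (c : Ctx n b A (q :: (Q1 ++ y1 :: (Q2 ++ y2 :: Q3))) R)
    (h1 : NJ (q :: (Q1 ++ y1 :: (Q2 ++ y2 :: Q3))) [b + 1]) (hx : NJ [b + 1] (R ++ [n + 1]))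
    (hq1 : Adj q y1) (hq2 : Adj q y2) (hne : y1 ≠ y2)
    (hqn : ∀ v, Q1.head? = some v → ¬ Adj q v)
    (hw1 : Q1.getLast? = some w1) (ha1 : Adj w1 y1)
    (hw2 : (Q1 ++ y1 :: Q2).getLast? = some w2) (ha2 : Adj w2 y2)
    (hn1 : NJ [y1] (Q2 ++ y2 :: Q3 ++ [b + 1])) (hn2 : NJ [y2] (Q3 ++ [b + 1])) :
    ∃ T T', IsMove (q :: (Q1 ++ y1 :: (Q2 ++ y2 :: Q3)) ++ (b + 1) :: R) T ∧ IsMove T T' ∧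
      Gain n 6 (A ++ q :: (Q1 ++ y1 :: (Q2 ++ y2 :: Q3)) ++ (b + 1) :: (R ++ [n + 1]))
        (A ++ T' ++ [n + 1]) ∧
      Psi n (Bd n (A ++ q :: (Q1 ++ y1 :: (Q2 ++ y2 :: Q3)) ++ (b + 1) :: (R ++ [n + 1]))) + 6
        ≤ 3 * n := by
  have e : q :: (Q1 ++ y1 :: (Q2 ++ y2 :: Q3)) = q :: (Q1 ++ [y1]) ++ (Q2 ++ [y2]) ++ Q3 := by simp
  have hQ1 : Q1 ≠ [] := by rintro rfl; simp at hw1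
  have hQ2 : Q2 ≠ [] := by
    rintro rfl
    rw [List.getLast?_append] at hw2
    simp at hw2
    subst hw2
    unfold Adj at *; omega
  have hw2' : Q2.getLast? = some w2 := by
    rw [List.getLast?_append, List.getLast?_cons] at hw2
    cases hQ : Q2.getLast? with
    | none => simp at hQ; exact absurd hQ hQ2
    | some z => simpa [hQ] using hw2
  rw [e] at c h1 ⊢
  have key := case_two c hx h1 (y1 := y1) (y2 := y2) (w1 := w1) (w2 := w2) ?_ ?_ ?_ (by simp) (by simp)
    hq1 hq2 hne ha1.symm ha2.symm (Con.of_jn ⟨hw1, by simp⟩).symm (Con.of_jn ⟨hw2', by simp⟩).symm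
  · refine ⟨q :: ((Q1 ++ [y1]) ++ (Q2 ++ [y2])).reverse ++ Q3 ++ (b + 1) :: R, _, ?_, ?_, key.1, key.2⟩
    · exact ⟨[q], (Q1 ++ [y1]) ++ (Q2 ++ [y2]), Q3 ++ (b + 1) :: R, [q], Q3 ++ (b + 1) :: R,
        by simp, by simp, Or.inr (by simp)⟩
    · exact ⟨q :: (Q2 ++ [y2]).reverse, (Q1 ++ [y1]).reverse ++ Q3 ++ [b + 1], R, [],
        q :: (Q2 ++ [y2]).reverse ++ R, by simp, by simp, Or.inr (by simp)⟩
  · intro u v hj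
    have h := hj.1
    simp at h
    subst h
    apply hqn
    have := hj.2
    cases Q1 <;> simp_all
  · intro u v hj
    refine hn1 u v ⟨?_, ?_⟩
    · have := hj.1
      rw [List.getLast?_append] at this
      simpa using this
    · have := hj.2
      cases Q2 <;> simp_all
  · intro u v hj
    refine hn2 u v ⟨?_, hj.2⟩
    have := hj.1
    rw [List.getLast?_append] at this
    simpa using this

def Step (n : ℕ) (A l : List ℕ) : Prop :=
  (∃ T, IsMove l T ∧ Gain n 3 (A ++ l ++ [n + 1]) (A ++ T ++ [n + 1]) ∧
    Psi n (Bd n (A ++ l ++ [n + 1])) + 3 ≤ 3 * n) ∨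
  (∃ T T', IsMove l T ∧ IsMove T T' ∧ Gain n 6 (A ++ l ++ [n + 1]) (A ++ T' ++ [n + 1]) ∧
    Psi n (Bd n (A ++ l ++ [n + 1])) + 6 ≤ 3 * n)

theorem step_b {n b q : ℕ} {A Q R : List ℕ} (c : Ctx n b A (q :: Q) R)
    (h1 : NJ (q :: Q) [b + 1]) (hx : NJ [b + 1] (R ++ [n + 1])) :
    Step n A (q :: Q ++ (b + 1) :: R) := by
  have hq := c.hQ q (by simp)
  have hbd := bound_b c h1 hx
  have e : A ++ (q :: Q ++ (b + 1) :: R) ++ [n + 1] = A ++ q :: Q ++ (b + 1) :: (R ++ [n + 1]) := by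
    simp
  unfold Step
  rw [e]
  by_cases hQ : ∃ q', Q.head? = some q' ∧ Adj q q'
  · left
    obtain ⟨q', hq', hqq⟩ := hQ
    obtain ⟨y, hy, hyq⟩ : ∃ y, Adj q y ∧ y ≠ q' := by
      unfold Adj at hqq ⊢
      rcases hqq with h | h
      · exact ⟨q - 1, by omega, by omega⟩
      · exact ⟨q + 1, by omega, by omega⟩
    rcases one_partner c h1 hx hy (by rw [hq']; simpa using hyq.symm) with ⟨T, hT, hG⟩ | ⟨Q1, Q2, w, rfl, hw, hwy, hn⟩
    · exact ⟨T, hT, hG, hbd⟩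
    · have hQ1 : Q1.head? = some q' := by
        cases Q1 with
        | nil => simp at hw
        | cons => simpa using hq'
      have nd := c.ndQ
      obtain ⟨T1, T2, hT, hT1, hT2, hNJ⟩ := exists_split (Q1 ++ [y]) q' y q
        (by cases Q1 <;> simp_all) (by simp) (by unfold Adj at *; omega)
        (by simp at nd ⊢; tauto)
      obtain ⟨F, rfl⟩ := List.head?_eq_some_iff.1 hT1
      have eQ : q :: (Q1 ++ y :: Q2) = q :: q' :: F ++ T2 ++ Q2 := by
        have : q :: (Q1 ++ y :: Q2) = q :: (Q1 ++ [y]) ++ Q2 := by simp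
        rw [this, hT]; simp
      rw [eQ] at c hbd ⊢
      refine ⟨_, ?_, strip_strip (y := y) (w := w) c hy hqq hT2 hwy ?_ hyq hNJ hn, hbd⟩
      · exact ⟨q :: q' :: F, T2, Q2 ++ (b + 1) :: R, [], q :: q' :: F ++ (Q2 ++ (b + 1) :: R),
          by simp, by simp, Or.inl (by simp)⟩
      · have : Con (Q1 ++ [y]) w y := Con.of_jn ⟨hw, by simp⟩
        rw [hT] at this
        exact this.mono ⟨[q], [], by simp⟩
  · push Not at hQ
    have a1 : Adj q (q - 1) := Or.inr (by omega)
    have a2 : Adj q (q + 1) := Or.inl rfl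
    rcases one_partner c h1 hx a1 (fun h => hQ _ h a1) with ⟨T, hT, hG⟩ | ⟨Q1, Q2, w, hQe, hw, hwy, hn⟩
    · exact Or.inl ⟨T, hT, hG, hbd⟩
    rcases one_partner c h1 hx a2 (fun h => hQ _ h a2) with ⟨T, hT, hG⟩ | ⟨Q1', Q2', w', hQe', hw', hwy', hn'⟩
    · exact Or.inl ⟨T, hT, hG, hbd⟩
    right
    have ndQ : Q.Nodup := (List.nodup_cons.1 c.ndQ).2
    have hm : q + 1 ∈ Q1 ++ (q - 1) :: Q2 := by rw [← hQe, hQe']; simp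
    rcases List.mem_append.1 hm with h | h
    · obtain ⟨V, V', rfl⟩ := List.append_of_mem h
      have : Q = V ++ (q + 1) :: (V' ++ (q - 1) :: Q2) := by rw [hQe]; simp
      obtain ⟨rfl, rfl⟩ := append_uniq (hQe' ▸ ndQ) (hQe'.symm.trans this)
      subst this
      refine two_moves c h1 hx a2 a1 (by omega) ?_ hw' hwy' hw hwy hn' hn
      intro v hv
      apply hQ
      cases Q1' <;> simp_all
    · rcases List.mem_cons.1 h with h | h
      · omega
      obtain ⟨V, V', rfl⟩ := List.append_of_mem h
      have : Q = (Q1 ++ (q - 1) :: V) ++ (q + 1) :: V' := by rw [hQe]; simp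
      obtain ⟨rfl, rfl⟩ := append_uniq (hQe' ▸ ndQ) (hQe'.symm.trans this)
      subst hQe
      refine two_moves c h1 hx a1 a2 (by omega) ?_ hw hwy hw' hwy' hn hn'
      intro v hv
      apply hQ
      cases Q1 <;> simp_all

theorem step_all {n b q : ℕ} {A Q R : List ℕ} (c : Ctx n b A (q :: Q) R) :
    Step n A (q :: Q ++ (b + 1) :: R) := by
  have hq := c.hQ q (by simp)
  have hb := c.hbn
  by_cases h1 : NJ (q :: Q) [b + 1]
  · by_cases hx : NJ [b + 1] (R ++ [n + 1])
    · exact step_b c h1 hx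
    · left
      have e : A ++ (q :: Q ++ (b + 1) :: R) ++ [n + 1] = A ++ q :: Q ++ (b + 1) :: (R ++ [n + 1]) := by
        simp
      rw [e]
      obtain ⟨x, r, hx', hr, hxr⟩ := not_NJ hx
      simp only [List.getLast?_singleton, Option.some.injEq] at hx'
      subst hx'
      have hqR : q ∉ R := c.disj (by simp)
      obtain ⟨T1, T2, hT, hT1, hT2, hNJ⟩ := exists_split ((b + 1) :: (R ++ [n + 1])) (b + 1) (n + 1) q
        (by simp) (by rw [← List.cons_append, List.getLast?_append]; simp) (by omega)
        (by simp; exact ⟨by omega, hqR, by omega⟩)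
      obtain ⟨T2', rfl⟩ := List.getLast?_eq_some_iff.1 hT2
      have hR : (b + 1) :: R = T1 ++ T2' := by
        rw [← List.cons_append, ← List.append_assoc] at hT
        exact List.append_cancel_right hT
      refine ⟨_, ?_, case_a2 c (by simp) h1 hr hxr hR hT1 hNJ, ?_⟩
      · rw [hR]
        exact ⟨[], q :: Q, T1 ++ T2', T1, T2', by simp, by simp, Or.inl (by simp)⟩
      · apply bound_a c
        have hr2 : r = b + 1 + 1 := by
          have hm := List.mem_of_mem_head? hr
          have : b + 2 ≤ r := by
            rcases List.mem_append.1 hm with h | h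
            · exact (c.hR r h).1
            · simp at h; omega
          unfold Adj at hxr; omega
        subst hr2
        have : Con ([b + 1] ++ (R ++ [n + 1])) (b + 1) (b + 1 + 1) := Con.of_jn ⟨by simp, hr⟩
        exact this.mono ⟨A ++ q :: Q, [], by simp⟩
  · left
    have e : A ++ (q :: Q ++ (b + 1) :: R) ++ [n + 1] = A ++ q :: Q ++ (b + 1) :: (R ++ [n + 1]) := by
      simp
    rw [e]
    obtain ⟨z, x, hz, hx', hzx⟩ := not_NJ h1
    simp only [List.head?_cons, Option.some.injEq] at hx'
    subst hx'
    refine ⟨_, ?_, case_a1 c hz hzx, ?_⟩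
    · exact ⟨[], q :: Q ++ [b + 1], R, [], R, by simp, by simp, Or.inr (by simp)⟩
    · apply bound_a c
      have hz2 : z = b + 1 + 1 := by
        have := c.hQ z (List.mem_of_mem_getLast? hz)
        unfold Adj at hzx; omega
      subst hz2
      have : Con (q :: Q ++ [b + 1]) (b + 1 + 1) (b + 1) := Con.of_jn ⟨hz, by simp⟩
      exact this.symm.mono ⟨A, R ++ [n + 1], by simp⟩

theorem IsMove.pre {P l l' : List ℕ} (h : IsMove l l') : IsMove (P ++ l) (P ++ l') := by
  obtain ⟨P', M, S, X, Y, h1, h2, h3⟩ := h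
  refine ⟨P ++ P', M, S, P ++ X, Y, by simp [h1], by simp [h2], ?_⟩
  rcases h3 with rfl | rfl
  · left; simp
  · right; simp

theorem IsMove.perm {l l' : List ℕ} (h : IsMove l l') : l'.Perm l := by
  obtain ⟨P, M, S, X, Y, rfl, h2, h3⟩ := h
  have e1 : ∀ M' : List ℕ, M'.Perm M → (X ++ M' ++ Y).Perm (P ++ M ++ S) := by
    intro M' hM
    have a : (X ++ M' ++ Y).Perm (M' ++ (X ++ Y)) := by
      rw [← List.append_assoc]
      exact List.perm_append_comm.append_right _
    have b : (P ++ M ++ S).Perm (M ++ (P ++ S)) := by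
      rw [← List.append_assoc]
      exact List.perm_append_comm.append_right _
    rw [h2] at a
    exact a.trans ((hM.append_right _).trans b.symm)
  rcases h3 with rfl | rfl
  · exact e1 M (List.Perm.refl _)
  · exact e1 _ (List.reverse_perm M)

theorem zero_range (b : ℕ) : 0 :: List.range' 1 b = List.range' 0 b ++ [b] := by
  rw [show 0 :: List.range' 1 b = List.range' 0 (b + 1) from by simp [List.range'_succ],
    List.range'_concat]
  simp

theorem decomp {n : ℕ} {l : List ℕ} (hp : l.Perm (List.range' 1 n)) (hne : l ≠ List.range' 1 n) :
    ∃ b q Q R, l = List.range' 1 b ++ (q :: Q ++ (b + 1) :: R) ∧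
      Ctx n b (0 :: List.range' 1 b) (q :: Q) R := by
  classical
  set b := Nat.findGreatest (fun b => List.range' 1 b <+: l) n with hb
  have hbn : b ≤ n := Nat.findGreatest_le n
  have hpre : List.range' 1 b <+: l :=
    Nat.findGreatest_spec (P := fun b => List.range' 1 b <+: l) (m := 0) (Nat.zero_le n) (by simp)
  obtain ⟨S, hS⟩ := hpre
  have hlen := hp.length_eq
  have hb1 : b + 1 ≤ n := by
    by_contra hcon
    have hbe : b = n := by omega
    apply hne
    rw [hbe] at hS
    rw [← hS] at hlen
    simp at hlen
    rw [← hS, hlen]; simp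
  have hmeml : ∀ v, v ∈ l ↔ 1 ≤ v ∧ v ≤ n := by
    intro v
    rw [hp.mem_iff, List.mem_range'_1]; omega
  have hbl : b + 1 ∈ l := (hmeml _).2 (by omega)
  have hbS : b + 1 ∈ S := by
    rw [← hS, List.mem_append] at hbl
    rcases hbl with h | h
    · rw [List.mem_range'_1] at h; omega
    · exact h
  obtain ⟨Q, R, rfl⟩ := List.append_of_mem hbS
  have hQ : Q ≠ [] := by
    rintro rfl
    have : List.range' 1 (b + 1) <+: l := by
      refine ⟨R, ?_⟩
      rw [← hS, List.range'_concat]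
      simp [Nat.add_comm]
    have := Nat.le_findGreatest (P := fun b => List.range' 1 b <+: l) hb1 this
    omega
  obtain ⟨q, Q, rfl⟩ := List.exists_cons_of_ne_nil hQ
  have ndl : l.Nodup := hp.nodup_iff.2 List.nodup_range'
  have ndf : (0 :: (l ++ [n + 1])).Nodup := by
    rw [List.nodup_cons, List.nodup_append]
    refine ⟨?_, ndl, by simp, ?_⟩
    · simp [hmeml]
    · intro v hv w hw
      simp at hw
      have := (hmeml v).1 hv
      omega
  have eF : 0 :: List.range' 1 b ++ q :: Q ++ (b + 1) :: (R ++ [n + 1]) = 0 :: (l ++ [n + 1]) := by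
    rw [← hS]; simp
  have ndl' := ndl
  rw [← hS, List.nodup_append] at ndl'
  obtain ⟨-, nd2, nd3⟩ := ndl'
  rw [List.nodup_append] at nd2
  refine ⟨b, q, Q, R, hS.symm, ⟨hb1, ?_, ?_, ?_, ?_, ?_, ?_, ?_⟩⟩
  · rw [zero_range]; simp
  · intro v
    rw [List.mem_cons, List.mem_range'_1]; omega
  · intro v hv
    have h1 := (hmeml v).1 (by rw [← hS]; simp at hv ⊢; tauto)
    have h2 : v ∉ List.range' 1 b := fun h => nd3 v h v (by simp at hv ⊢; tauto) rfl
    rw [List.mem_range'_1] at h2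
    have h3 : v ≠ b + 1 := nd2.2.2 v hv (b + 1) (by simp)
    omega
  · intro v hv
    have h1 := (hmeml v).1 (by rw [← hS]; simp [hv])
    have h2 : v ∉ List.range' 1 b := fun h => nd3 v h v (by simp [hv]) rfl
    rw [List.mem_range'_1] at h2
    have h3 : v ≠ b + 1 := by
      rintro rfl
      exact (List.nodup_cons.1 nd2.2.1).1 hv
    omega
  · intro v h1 h2
    have h := (hmeml v).2 (by omega)
    rw [← hS, List.mem_append, List.mem_append, List.mem_range'_1] at h
    rcases h with h | h | h
    · omega
    · exact Or.inl h
    · rcases List.mem_cons.1 h with h | h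
      · omega
      · exact Or.inr h
  · rw [eF]; exact ndf
  · rcases Nat.eq_zero_or_pos b with h0 | h0
    · rw [h0]; simp [Sing]
    · obtain ⟨p, hpb⟩ : ∃ p, b = p + 1 := ⟨b - 1, by omega⟩
      refine not_sing (c := p) (Or.inr (by omega)) (Or.inr ?_)
      rw [zero_range, hpb, List.range'_concat]
      exact ⟨List.range' 0 p, q :: Q ++ (p + 1 + 1) :: (R ++ [n + 1]), by simp⟩

theorem main_ind (n : ℕ) : ∀ m, ∀ l : List ℕ, l.Perm (List.range' 1 n) → l ≠ List.range' 1 n →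
    3 * n - Psi n (Bd n (fr n l)) ≤ m →
    ∃ k, 3 * k + Psi n (Bd n (fr n l)) ≤ 3 * n ∧ MoveSeq k l (List.range' 1 n) := by
  intro m
  induction m using Nat.strong_induction_on with
  | _ m ih =>
  intro l hp hne hm
  obtain ⟨b, q, Q, R, hl, c⟩ := decomp hp hne
  have hs := step_all c
  have ef : ∀ T, 0 :: List.range' 1 b ++ T ++ [n + 1] = fr n (List.range' 1 b ++ T) := by
    intro T; simp [fr]
  unfold Step at hs
  simp only [ef] at hs
  rw [← hl] at hs
  rcases hs with ⟨T, hT, hG, hB⟩ | ⟨T, T', hT, hT', hG, hB⟩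
  · have hmv : IsMove l (List.range' 1 b ++ T) := by rw [hl]; exact IsMove.pre hT
    unfold Gain at hG
    by_cases hd : List.range' 1 b ++ T = List.range' 1 n
    · exact ⟨1, by omega, MoveSeq.step (hd ▸ hmv) (MoveSeq.refl _)⟩
    · obtain ⟨k, hk, hk'⟩ := ih (3 * n - Psi n (Bd n (fr n (List.range' 1 b ++ T)))) (by omega) _
        ((IsMove.perm hmv).trans hp) hd le_rfl
      exact ⟨k + 1, by omega, MoveSeq.step hmv hk'⟩
  · have hmv : IsMove l (List.range' 1 b ++ T) := by rw [hl]; exact IsMove.pre hT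
    have hmv' : IsMove (List.range' 1 b ++ T) (List.range' 1 b ++ T') := IsMove.pre hT'
    unfold Gain at hG
    by_cases hd : List.range' 1 b ++ T' = List.range' 1 n
    · exact ⟨2, by omega, MoveSeq.step hmv (MoveSeq.step (hd ▸ hmv') (MoveSeq.refl _))⟩
    · obtain ⟨k, hk, hk'⟩ := ih (3 * n - Psi n (Bd n (fr n (List.range' 1 b ++ T')))) (by omega) _
        ((IsMove.perm hmv').trans ((IsMove.perm hmv).trans hp)) hd le_rfl
      exact ⟨k + 1 + 1, by omega, MoveSeq.step hmv (MoveSeq.step hmv' hk')⟩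

end CP

/-- Every permutation of `[n]` can be sorted in at most `⌊2n/3⌋`
cut-and-paste moves. -/
theorem upper_bound_two_thirds (n : ℕ) (l : List ℕ) (hperm : l.Perm (List.range' 1 n)) :
    ∃ k ≤ 2 * n / 3, MoveSeq k l (List.range' 1 n) := by
  by_cases h : l = List.range' 1 n
  · subst h
    exact ⟨0, Nat.zero_le _, MoveSeq.refl _⟩
  · obtain ⟨k, hk, hk'⟩ := CP.main_ind n _ l hperm h le_rfl
    have := CP.psi_start n (CP.Bd n (CP.fr n l))
    exact ⟨k, by omega, hk'⟩
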